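/- arXiv:math/0411352 — 2 statements merged into one kernel-verified Lean document; each statement's English description precedes it below -/
import Mathlib

section
/- Let k be a commutative ring, R a commutative k-algebra, and L a Lie algebra over k that is also an R-module. Let ρ : L → Der_k(R) be a map into the k-linear derivations of R satisfying the compatibility condition ⁅σ, f • η⁆ = f • ⁅σ, η⁆ + (ρ(σ) f) • η for all σ, η ∈ L and f ∈ R. If L is a faithful R-module (i.e., f • η = 0 for all η ∈ L implies f = 0), then ρ(⁅σ, η⁆) = ρ(σ) ∘ ρ(η) − ρ(η) ∘ ρ(σ) (the commutator bracket of derivations) for all σ, η ∈ L; that is, ρ is a homomorphism into the Lie algebra of derivations. -/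
/-- If `L` is a Lie algebra over `k` which is also a faithful `R`-module, and
`ρ : L → Der_k(R)` satisfies the Leibniz-type compatibility condition
`⁅σ, f • η⁆ = f • ⁅σ, η⁆ + (ρ σ f) • η`, then `ρ` takes brackets to
commutators of derivations, i.e. it is a homomorphism into the Lie algebra
of derivations. -/
theorem anchor_is_lie_hom
    (k R L : Type*) [CommRing k] [CommRing R] [Algebra k R]
    [LieRing L] [LieAlgebra k L] [Module R L]
    (ρ : L → Derivation k R R)
    (compat : ∀ (σ η : L) (f : R), ⁅σ, f • η⁆ = f • ⁅σ, η⁆ + (ρ σ f) • η)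
    (faithful : ∀ f : R, (∀ η : L, f • η = 0) → f = 0) :
    ∀ (σ η : L) (f : R),
      ρ ⁅σ, η⁆ f = ρ σ (ρ η f) - ρ η (ρ σ f) := by
  intro σ η f
  rw [← sub_eq_zero]
  refine faithful _ fun ζ => ?_
  have h := lie_lie σ η (f • ζ)
  simp only [compat, lie_add, lie_lie σ η ζ, smul_sub] at h
  simp only [sub_smul]
  rw [← sub_eq_zero] at h
  rw [← h]
  abel
end

section
/- Let k be a field, E and F finite-dimensional k-vector spaces, and π : E → F a surjective linear map with kernel K = ker π. For linear maps p, q : E → F, the following are equivalent: (i) tr(p ∘ φ) = tr(q ∘ φ) for every splitting φ of π (i.e., every linear φ : F → E with π ∘ φ = id_F); (ii) there exists a linear map r : F → F with tr(r) = 0 such that p − q = r ∘ π. In particular, (i) implies that p and q agree on K. -/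
/-- A linear map `d` with `tr (d ∘ φ) = 0` for every splitting `φ` of `π` vanishes on `ker π`. -/
theorem apply_eq_zero_of_trace_comp_splitting_eq_zero
    {k E F : Type*} [Field k] [AddCommGroup E] [Module k E]
    [AddCommGroup F] [Module k F] [FiniteDimensional k F]
    {π d : E →ₗ[k] F} (hπ : Function.Surjective π)
    (h : ∀ φ : F →ₗ[k] E, π ∘ₗ φ = LinearMap.id → LinearMap.trace k F (d ∘ₗ φ) = 0)
    {x : E} (hx : x ∈ LinearMap.ker π) : d x = 0 := by
  obtain ⟨s, hs⟩ := π.exists_rightInverse_of_surjective (LinearMap.range_eq_top.2 hπ)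
  rw [LinearMap.mem_ker] at hx
  refine (Module.forall_dual_apply_eq_zero_iff k (d x)).1 fun f => ?_
  have hsplit : π ∘ₗ (s + f.smulRight x) = LinearMap.id := by
    rw [LinearMap.comp_add, hs]
    ext y
    simp [hx]
  have hcomp : d ∘ₗ f.smulRight x = f.smulRight (d x) := by
    ext y
    simp
  have key := h _ hsplit
  rwa [LinearMap.comp_add, map_add, h s hs, zero_add, hcomp,
    LinearMap.trace_smulRight] at key

/-- Two linear maps `p q : E → F` induce the same affine function `φ ↦ tr (p ∘ φ)` on
the set of splittings of a surjective linear map `π : E → F` iff `p - q = r ∘ π` for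
some trace-free endomorphism `r` of `F`; in particular they then agree on `ker π`. -/
theorem same_affine_function_iff
    (k E F : Type*) [Field k]
    [AddCommGroup E] [Module k E] [FiniteDimensional k E]
    [AddCommGroup F] [Module k F] [FiniteDimensional k F]
    (π : E →ₗ[k] F) (hπ : Function.Surjective π)
    (p q : E →ₗ[k] F) :
    ((∀ φ : F →ₗ[k] E, π ∘ₗ φ = LinearMap.id →
        LinearMap.trace k F (p ∘ₗ φ) = LinearMap.trace k F (q ∘ₗ φ)) ↔
      (∃ r : F →ₗ[k] F, LinearMap.trace k F r = 0 ∧ p - q = r ∘ₗ π)) ∧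
    ((∀ φ : F →ₗ[k] E, π ∘ₗ φ = LinearMap.id →
        LinearMap.trace k F (p ∘ₗ φ) = LinearMap.trace k F (q ∘ₗ φ)) →
      ∀ x ∈ LinearMap.ker π, p x = q x) := by
  have vanish (h : ∀ φ : F →ₗ[k] E, π ∘ₗ φ = LinearMap.id →
      LinearMap.trace k F (p ∘ₗ φ) = LinearMap.trace k F (q ∘ₗ φ)) :
      ∀ x ∈ LinearMap.ker π, (p - q) x = 0 := fun x hx =>
    apply_eq_zero_of_trace_comp_splitting_eq_zero hπ
      (fun φ hφ => by rw [LinearMap.sub_comp, map_sub, h φ hφ, sub_self]) hx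
  refine ⟨⟨fun h => ?_, ?_⟩, fun h x hx => sub_eq_zero.1 (vanish h x hx)⟩
  · obtain ⟨s, hs⟩ := π.exists_rightInverse_of_surjective (LinearMap.range_eq_top.2 hπ)
    refine ⟨(p - q) ∘ₗ s, by rw [LinearMap.sub_comp, map_sub, h s hs, sub_self], ?_⟩
    ext x
    have hx : x - s (π x) ∈ LinearMap.ker π := by
      rw [LinearMap.mem_ker, map_sub, ← LinearMap.comp_apply π s, hs, LinearMap.id_apply, sub_self]
    have hd := vanish h _ hx
    rwa [map_sub, sub_eq_zero] at hd
  · rintro ⟨r, hr, hpq⟩ φ hφ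
    rw [← sub_eq_zero, ← map_sub, ← LinearMap.sub_comp, hpq, LinearMap.comp_assoc, hφ,
      LinearMap.comp_id, hr]
end
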